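/- Let n be a positive integer and T > 0. Let f : ℝⁿ → ℝⁿ be continuous, let g : ℝⁿ → (n×n real matrices) be continuous, and let V : ℝⁿ × ℝ → ℝ be continuously differentiable and satisfy the Hamilton–Jacobi–Bellman equation ∂ₜV(x,t) + ⟨∇ₓV(x,t), f(x)⟩ − (1/2)‖g(x)ᵀ∇ₓV(x,t)‖² = 0 for all x ∈ ℝⁿ and t ∈ [0,T]. Let U : [0,T] → ℝⁿ be continuous and let X : [0,T] → ℝⁿ be continuously differentiable with X′(t) = f(X(t)) + g(X(t)) U(t) for all t ∈ [0,T]. Then (1/2)∫₀ᵀ ‖U(t)‖² dt = V(X(0),0) − V(X(T),T) + (1/2)∫₀ᵀ ‖U(t) + g(X(t))ᵀ∇ₓV(X(t),t)‖² dt. -/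

import Mathlib

open scoped RealInnerProductSpace
open Set

lemma aux_cont {n : ℕ} : Continuous (fun p : Matrix (Fin n) (Fin n) ℝ × EuclideanSpace ℝ (Fin n) =>
    Matrix.toEuclideanLin p.1 p.2) := by
  have : (fun p : Matrix (Fin n) (Fin n) ℝ × EuclideanSpace ℝ (Fin n) =>
    Matrix.toEuclideanLin p.1 p.2) = fun p => WithLp.toLp 2 (p.1.mulVec p.2.ofLp) := by
    funext p
    rfl
  rw [this]
  refine (PiLp.continuous_toLp 2 _).comp ?_
  exact Continuous.matrix_mulVec continuous_fst ((PiLp.continuous_ofLp 2 _).comp continuous_snd)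

lemma aux_contOn {n : ℕ} {s : Set ℝ} {A : ℝ → Matrix (Fin n) (Fin n) ℝ}
    {v : ℝ → EuclideanSpace ℝ (Fin n)} (hA : ContinuousOn A s) (hv : ContinuousOn v s) :
    ContinuousOn (fun t => Matrix.toEuclideanLin (A t) (v t)) s :=
  Continuous.comp_continuousOn (f := fun t => (A t, v t)) aux_cont (hA.prodMk hv)

lemma aux_adj {n : ℕ} (A : Matrix (Fin n) (Fin n) ℝ) (u v : EuclideanSpace ℝ (Fin n)) :
    ⟪v, Matrix.toEuclideanLin A u⟫ = ⟪u, Matrix.toEuclideanLin A.transpose v⟫ := by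
  have h : Matrix.toEuclideanLin A.transpose = LinearMap.adjoint (Matrix.toEuclideanLin A) := by
    rw [← Matrix.toEuclideanLin_conjTranspose_eq_adjoint, Matrix.conjTranspose_eq_transpose_of_trivial]
  rw [h, LinearMap.adjoint_inner_right, real_inner_comm]

/-- Decomposition of the control effort of an arbitrary admissible path:
if `V` solves the Hamilton–Jacobi–Bellman equation
`∂ₜV + ⟨∇ₓV, f⟩ − (1/2)‖gᵀ∇ₓV‖² = 0`, and `X′ = f(X) + g(X)U`, then
`(1/2)∫₀ᵀ‖U‖² = V(X₀,0) − V(X_T,T) + (1/2)∫₀ᵀ‖U + gᵀ∇ₓV‖²`. -/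
theorem stmt_2 {n : ℕ} (hn : 0 < n) (T : ℝ) (hT : 0 < T)
    (f : EuclideanSpace ℝ (Fin n) → EuclideanSpace ℝ (Fin n)) (hf : Continuous f)
    (g : EuclideanSpace ℝ (Fin n) → Matrix (Fin n) (Fin n) ℝ) (hg : Continuous g)
    (V : EuclideanSpace ℝ (Fin n) → ℝ → ℝ)
    (hV : ContDiff ℝ 1 (fun p : EuclideanSpace ℝ (Fin n) × ℝ => V p.1 p.2))
    (hHJB : ∀ (x : EuclideanSpace ℝ (Fin n)), ∀ t ∈ Icc (0:ℝ) T,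
      deriv (V x) t + ⟪gradient (fun y => V y t) x, f x⟫
          - (1 / 2) * ‖Matrix.toEuclideanLin (g x).transpose
              (gradient (fun y => V y t) x)‖ ^ 2 = 0)
    (U : ℝ → EuclideanSpace ℝ (Fin n)) (hU : ContinuousOn U (Icc 0 T))
    (X : ℝ → EuclideanSpace ℝ (Fin n))
    (hX : ∀ t ∈ Icc (0:ℝ) T,
      HasDerivAt X (f (X t) + Matrix.toEuclideanLin (g (X t)) (U t)) t) :
    (1 / 2) * ∫ t in (0:ℝ)..T, ‖U t‖ ^ 2
      = V (X 0) 0 - V (X T) T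
        + (1 / 2) * ∫ t in (0:ℝ)..T,
            ‖U t + Matrix.toEuclideanLin (g (X t)).transpose
                (gradient (fun y => V y t) (X t))‖ ^ 2 := by
  set W : EuclideanSpace ℝ (Fin n) × ℝ → ℝ := fun p => V p.1 p.2 with hW
  have hD : ∀ p, HasFDerivAt W (fderiv ℝ W p) p := fun p =>
    (hV.differentiable (by norm_num) p).hasFDerivAt
  have hDc : Continuous (fderiv ℝ W) := hV.continuous_fderiv (by norm_num)
  have hgrad : ∀ x t, gradient (fun y => V y t) x =
      (InnerProductSpace.toDual ℝ _).symm
        ((fderiv ℝ W (x, t)).comp (ContinuousLinearMap.inl ℝ _ ℝ)) := by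
    intro x t
    have h : HasFDerivAt (fun y => V y t)
        ((fderiv ℝ W (x, t)).comp (ContinuousLinearMap.inl ℝ _ ℝ)) x :=
      HasFDerivAt.comp (g := W) (f := fun y => (y, t)) x (hD (x, t)) (hasFDerivAt_prodMk_left x t)
    rw [gradient, h.fderiv]
  have hgi : ∀ x t v, ⟪gradient (fun y => V y t) x, v⟫ = fderiv ℝ W (x, t) (v, 0) := by
    intro x t v
    rw [hgrad, InnerProductSpace.toDual_symm_apply]
    simp
  have hdt : ∀ x t, deriv (V x) t = fderiv ℝ W (x, t) (0, 1) := by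
    intro x t
    have h : HasFDerivAt (V x)
        ((fderiv ℝ W (x, t)).comp (ContinuousLinearMap.inr ℝ _ ℝ)) t :=
      HasFDerivAt.comp (g := W) (f := fun s => (x, s)) t (hD (x, t)) (hasFDerivAt_prodMk_right x t)
    rw [h.hasDerivAt.deriv]
    simp
  have hXc : ContinuousOn X (Icc 0 T) := fun t ht => (hX t ht).continuousAt.continuousWithinAt
  have hGc : ContinuousOn (fun t => gradient (fun y => V y t) (X t)) (Icc 0 T) := by
    simp_rw [hgrad]
    refine (InnerProductSpace.toDual ℝ _).symm.continuous.comp_continuousOn ?_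
    refine ContinuousOn.clm_comp ?_ continuousOn_const
    exact hDc.comp_continuousOn (hXc.prodMk continuousOn_id)
  have hBc : ContinuousOn (fun t => Matrix.toEuclideanLin (g (X t)).transpose
      (gradient (fun y => V y t) (X t))) (Icc 0 T) := by
    have hgt : ContinuousOn (fun t => (g (X t)).transpose) (Icc 0 T) :=
      (hg.matrix_transpose).comp_continuousOn hXc
    exact aux_contOn hgt hGc
  have hu : uIcc 0 T = Icc 0 T := uIcc_of_le hT.le
  have hI1 : IntervalIntegrable (fun t => ‖U t‖ ^ 2) MeasureTheory.volume 0 T := by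
    apply ContinuousOn.intervalIntegrable
    rw [hu]
    exact hU.norm.pow 2
  have hI2 : IntervalIntegrable (fun t => ‖U t + Matrix.toEuclideanLin (g (X t)).transpose
      (gradient (fun y => V y t) (X t))‖ ^ 2) MeasureTheory.volume 0 T := by
    apply ContinuousOn.intervalIntegrable
    rw [hu]
    exact (hU.add hBc).norm.pow 2
  have key : ∀ t ∈ uIcc 0 T, HasDerivAt (fun t => V (X t) t)
      ((1 / 2) * ‖U t + Matrix.toEuclideanLin (g (X t)).transpose
      (gradient (fun y => V y t) (X t))‖ ^ 2 - (1 / 2) * ‖U t‖ ^ 2) t := by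
    intro t ht
    rw [hu] at ht
    have h := HasFDerivAt.comp_hasDerivAt (l := W) (f := fun s => (X s, id s)) t (hD (X t, t)) ((hX t ht).prodMk (hasDerivAt_id t))
    refine HasDerivAt.congr_deriv h ?_
    have e : ((f (X t) + Matrix.toEuclideanLin (g (X t)) (U t), 1) :
        EuclideanSpace ℝ (Fin n) × ℝ) = (f (X t), 0) +
        ((Matrix.toEuclideanLin (g (X t)) (U t), 0) + (0, 1)) := by simp
    rw [e, map_add, map_add, ← hgi, ← hgi, ← hdt, aux_adj, norm_add_sq_real]
    linarith [hHJB (X t) t ht]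
  have fin := intervalIntegral.integral_eq_sub_of_hasDerivAt key
    ((hI2.const_mul _).sub (hI1.const_mul _))
  rw [intervalIntegral.integral_sub (hI2.const_mul _) (hI1.const_mul _),
    intervalIntegral.integral_const_mul, intervalIntegral.integral_const_mul] at fin
  linarith
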